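/- arXiv:1508.06904 — 9 statements merged into one kernel-verified Lean document; each statement's English description precedes it below -/
import Mathlib

section
/- Let M, N be sets, c ∈ ℕ₊, and let T₁, T₂ : ⋃_{q≥c} M^q → ⋃_{q≥1} N^q be subsignal compatible transformations with the same dimensionality reduction constant c. If T₁(ρ) = T₂(ρ) for all ρ ∈ M^c, then T₁ = T₂, i.e. T₁(ξ) = T₂(ξ) for all signals ξ ∈ M^D with D ≥ c. -/
namespace Scan

/-- Extraction of the subsignal of length `d` starting at (0-based) index `i`. -/
def subsig {M : Type*} {D : ℕ} (d i : ℕ) (ξ : Fin D → M) (h : i + d ≤ D) : Fin d → M :=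
  fun ν => ξ ⟨i + ν.val, by have := ν.isLt; omega⟩

/-- `T` is a subsignal compatible transformation with dimensionality reduction
constant `c`: the dimensionality reduction property is encoded in the type of `T`
(a signal with `D` samples is mapped to one with `D - c + 1` samples), and this
predicate is the exchange property, stated sample-wise. -/
def IsSCT {M N : Type*} (c : ℕ) (T : ∀ D : ℕ, (Fin D → M) → Fin (D + 1 - c) → N) : Prop :=
  ∀ (d D : ℕ), c ≤ d → ∀ (ξ : Fin D → M) (i : ℕ) (h : i + d ≤ D),
    ∀ ν : Fin (d + 1 - c),
      T d (subsig d i ξ h) ν = T D ξ ⟨i + ν.val, by have := ν.isLt; omega⟩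

/-- identity theorem for subsignal compatible transformations.
If two subsignal compatible transformations with the same dimensionality
reduction constant `c` agree on all signals with exactly `c` samples, then they
agree on all signals with at least `c` samples. -/
theorem sct_identity {M N : Type*} (c : ℕ) (hc : 0 < c)
    (T₁ T₂ : ∀ D : ℕ, (Fin D → M) → Fin (D + 1 - c) → N)
    (h₁ : IsSCT c T₁) (h₂ : IsSCT c T₂)
    (hagree : ∀ ρ : Fin c → M, T₁ c ρ = T₂ c ρ) :
    ∀ (D : ℕ), c ≤ D → ∀ ξ : Fin D → M, T₁ D ξ = T₂ D ξ := by
  intro D _ ξ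
  funext ⟨j, hj⟩
  have e₁ := h₁ c D le_rfl ξ j (by omega) ⟨0, by omega⟩
  have e₂ := h₂ c D le_rfl ξ j (by omega) ⟨0, by omega⟩
  rw [hagree] at e₁
  exact e₁.symm.trans e₂

end Scan
end

section
/- Let M, N be sets, c ∈ ℕ₊, and let T : ⋃_{q≥c} M^q → ⋃_{q≥1} N^q be a function. The following are equivalent: (1) T is a subsignal compatible transformation with dimensionality reduction constant c; (2) T satisfies the dimensionality reduction property dim(T(ξ)) = dim(ξ) − c + 1 for all ξ, and T(Subsignal_c(ξ, i)) = T(ξ)_i for all ξ ∈ M^D with D ≥ c and all i ∈ {1,…,D−c+1}; (3) there exists a unique function f : M^c → N with T = Slide_f. -/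
namespace Scan

/-- Application of a function in a sliding fashion. -/
def slide {M N : Type*} {c : ℕ} (f : (Fin c → M) → N) {D : ℕ} (ξ : Fin D → M) :
    Fin (D + 1 - c) → N :=
  fun i => f (subsig c i.val ξ (by have := i.isLt; omega))

theorem subsig_zero_self {M : Type*} {d : ℕ} (ξ : Fin d → M) (h : 0 + d ≤ d) :
    subsig d 0 ξ h = ξ := by
  funext ν
  simp [subsig]

theorem subsig_subsig {M : Type*} {c d D i j : ℕ} (ξ : Fin D → M) (h : i + d ≤ D)
    (h' : j + c ≤ d) :
    subsig c j (subsig d i ξ h) h' = subsig c (i + j) ξ (by omega) := by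
  funext ν
  simp [subsig, Nat.add_assoc]

theorem isSCT_slide {M N : Type*} {c : ℕ} (f : (Fin c → M) → N) :
    IsSCT c (fun _ ξ => slide f ξ) := by
  intro d D _ ξ i h ν
  simp only [slide, subsig_subsig]

theorem existsUnique_eq_slide {M N : Type*} {c : ℕ} (h0 : 0 < c + 1 - c)
    {T : ∀ D : ℕ, (Fin D → M) → Fin (D + 1 - c) → N}
    (hT : ∀ (D : ℕ) (ξ : Fin D → M) (i : Fin (D + 1 - c)) (h : i.val + c ≤ D),
      T c (subsig c i.val ξ h) ⟨0, h0⟩ = T D ξ i) :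
    ∃! f : (Fin c → M) → N, ∀ (D : ℕ) (ξ : Fin D → M), T D ξ = slide f ξ := by
  refine ⟨fun ξ => T c ξ ⟨0, h0⟩, fun D ξ => ?_, fun g hg => ?_⟩
  · funext i
    exact (hT D ξ i (by have := i.isLt; omega)).symm
  · funext ξ
    simp only [hg, slide, subsig_zero_self]

theorem isSCT_of_eq_slide {M N : Type*} {c : ℕ}
    {T : ∀ D : ℕ, (Fin D → M) → Fin (D + 1 - c) → N} {f : (Fin c → M) → N}
    (hf : ∀ (D : ℕ) (ξ : Fin D → M), T D ξ = slide f ξ) : IsSCT c T := by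
  obtain rfl : T = fun _ ξ => slide f ξ := by
    funext D ξ
    exact hf D ξ
  exact isSCT_slide f

/-- characterization of subsignal compatible transformations.
(1) `T` is a subsignal compatible transformation with dimensionality reduction
constant `c` iff (2) `T(Subsignal_c(ξ, i)) = T(ξ)_i` for all `ξ` and all valid `i`
(the dimensionality reduction property holds by the type of `T`), iff
(3) there is a unique function `f : M^c → N` with `T = Slide_f`. -/
theorem sct_tfae {M N : Type*} (c : ℕ) (hc : 0 < c)
    (T : ∀ D : ℕ, (Fin D → M) → Fin (D + 1 - c) → N) :
    (IsSCT c T ↔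
      (∀ (D : ℕ) (ξ : Fin D → M) (i : ℕ) (h : i + c ≤ D),
        T c (subsig c i ξ h) ⟨0, by omega⟩ = T D ξ ⟨i, by omega⟩)) ∧
    (IsSCT c T ↔
      (∃! f : (Fin c → M) → N, ∀ (D : ℕ) (ξ : Fin D → M), T D ξ = slide f ξ)) := by
  have h0 : 0 < c + 1 - c := by omega
  refine ⟨⟨fun h D ξ i hi => h c D le_rfl ξ i hi ⟨0, h0⟩, fun h => ?_⟩, fun h => ?_, ?_⟩
  · obtain ⟨f, hf, -⟩ := existsUnique_eq_slide h0 fun D ξ i hi => h D ξ i.val hi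
    exact isSCT_of_eq_slide hf
  · exact existsUnique_eq_slide h0 fun D ξ i hi => h c D le_rfl ξ i.val hi ⟨0, h0⟩
  · rintro ⟨f, hf, -⟩
    exact isSCT_of_eq_slide hf

end Scan
end

section
/- Let M, N, P be sets and c₁, c₂ ∈ ℕ₊. Suppose T₁ : ⋃_{q≥c₁} M^q → ⋃_{q≥1} N^q is a subsignal compatible transformation with dimensionality reduction constant c₁, and T₂ : ⋃_{q≥c₂} N^q → ⋃_{q≥1} P^q is a subsignal compatible transformation with dimensionality reduction constant c₂. Set c := c₁ + c₂ − 1 ∈ ℕ₊. Then the composition T : ⋃_{q≥c} M^q → ⋃_{q≥1} P^q, ξ ↦ T₂(T₁(ξ)), is well-defined (i.e. T₁(ξ) has at least c₂ samples whenever dim(ξ) ≥ c) and is a subsignal compatible transformation with dimensionality reduction constant c. -/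
namespace Scan

/-- the composition of two subsignal compatible transformations with
dimensionality reduction constants `c₁` and `c₂` is well-defined (the intermediate
signal has at least `c₂` samples whenever the input has at least `c₁ + c₂ - 1`
samples) and is a subsignal compatible transformation with dimensionality
reduction constant `c₁ + c₂ - 1`. -/
theorem sct_comp {M N P : Type*} (c₁ c₂ : ℕ) (hc₁ : 0 < c₁) (hc₂ : 0 < c₂)
    (T₁ : ∀ D : ℕ, (Fin D → M) → Fin (D + 1 - c₁) → N)
    (T₂ : ∀ D : ℕ, (Fin D → N) → Fin (D + 1 - c₂) → P)
    (h₁ : IsSCT c₁ T₁) (h₂ : IsSCT c₂ T₂) :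
    (∀ D : ℕ, c₁ + c₂ - 1 ≤ D → c₂ ≤ D + 1 - c₁) ∧
    IsSCT (c₁ + c₂ - 1)
      (fun D ξ i => T₂ (D + 1 - c₁) (T₁ D ξ) (Fin.cast (by omega) i)) := by
  refine ⟨fun D hD => by omega, fun d D hd ξ i h ν => ?_⟩
  have hT₁ : T₁ d (subsig d i ξ h) =
      subsig (d + 1 - c₁) i (T₁ D ξ) (by omega) :=
    funext fun μ => h₁ d D (by omega) ξ i h μ
  simp only [hT₁]
  exact h₂ (d + 1 - c₁) (D + 1 - c₁) (by omega) (T₁ D ξ) i (by omega) (Fin.cast (by omega) ν)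

end Scan
end

section
/- Let n ∈ ℕ with n ≥ 2 and let M₁,…,M_{n+1} be sets. For each λ ∈ {1,…,n} let T_λ : ⋃_{q≥c_λ} M_λ^q → ⋃_{q≥1} M_{λ+1}^q be a subsignal compatible transformation with dimensionality reduction constant c_λ ∈ ℕ₊. Set c := (Σ_{μ=1}^n c_μ) − n + 1 ∈ ℕ₊. Then the n-fold composition T : ⋃_{q≥c} M₁^q → ⋃_{q≥1} M_{n+1}^q, ξ ↦ T_n(T_{n−1}(⋯T₁(ξ)⋯)), is well-defined and is a subsignal compatible transformation with dimensionality reduction constant c. -/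
namespace Scan

/-- Dimensionality of a signal of length `D` after `n` layers of subsignal
compatible transformations with dimensionality reduction constants `c 0, …, c (n-1)`. -/
def chainDim (c : ℕ → ℕ) : ℕ → ℕ → ℕ
  | 0, D => D
  | n + 1, D => chainDim c n D + 1 - c n

/-- The `n`-fold composition `T_{n-1} ∘ ⋯ ∘ T_0`. -/
def compChain {M : ℕ → Type*} (c : ℕ → ℕ)
    (T : ∀ l : ℕ, ∀ D : ℕ, (Fin D → M l) → Fin (D + 1 - c l) → M (l + 1)) :
    ∀ (n D : ℕ), (Fin D → M 0) → Fin (chainDim c n D) → M n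
  | 0, _, ξ => ξ
  | n + 1, D, ξ => T n (chainDim c n D) (compChain c T n D ξ)

lemma chainDim_eq (c : ℕ → ℕ) : ∀ (n : ℕ), (∀ l, l < n → 0 < c l) → ∀ D : ℕ,
    chainDim c n D = D + 1 - (∑ μ ∈ Finset.range n, c μ - n + 1) := by
  intro n
  induction n with
  | zero => intro _ D; simp [chainDim]
  | succ m ih =>
    intro hc D
    have hS : m ≤ ∑ μ ∈ Finset.range m, c μ := by
      calc m = ∑ _μ ∈ Finset.range m, 1 := by simp
        _ ≤ ∑ μ ∈ Finset.range m, c μ :=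
          Finset.sum_le_sum fun μ hμ =>
            hc μ (lt_of_lt_of_le (Finset.mem_range.mp hμ) (Nat.le_succ m))
    have hcm : 1 ≤ c m := hc m (Nat.lt_succ_self m)
    have ihm := ih (fun l hl => hc l (hl.trans (Nat.lt_succ_self m))) D
    rw [show chainDim c (m + 1) D = chainDim c m D + 1 - c m from rfl, ihm,
      Finset.sum_range_succ]
    omega

lemma add_chainDim_le (c : ℕ → ℕ) (n : ℕ) (hc : ∀ l, l < n → 0 < c l) {i d D : ℕ}
    (h : i + d ≤ D) (hd : 0 < chainDim c n d) : i + chainDim c n d ≤ chainDim c n D := by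
  rw [chainDim_eq c n hc] at hd ⊢
  rw [chainDim_eq c n hc]
  omega

lemma compChain_subsig {M : ℕ → Type*} (c : ℕ → ℕ)
    (T : ∀ l : ℕ, ∀ D : ℕ, (Fin D → M l) → Fin (D + 1 - c l) → M (l + 1)) {d D : ℕ}
    (ξ : Fin D → M 0) (i : ℕ) (h : i + d ≤ D) (n : ℕ) (hc : ∀ l, l < n → 0 < c l)
    (hT : ∀ l, l < n → IsSCT (c l) (T l)) (h' : i + chainDim c n d ≤ chainDim c n D) :
    compChain c T n d (subsig d i ξ h) =
      subsig (chainDim c n d) i (compChain c T n D ξ) h' := by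
  induction n with
  | zero => rfl
  | succ m ih =>
    funext ν
    have hν : ν.val < chainDim c m d + 1 - c m := ν.isLt
    have hcm : 0 < c m := hc m m.lt_succ_self
    have hc' : ∀ l, l < m → 0 < c l := fun l hl => hc l (hl.trans m.lt_succ_self)
    have hle := add_chainDim_le c m hc' h (by omega)
    have hstep := ih hc' (fun l hl => hT l (hl.trans m.lt_succ_self)) hle
    change T m (chainDim c m d) (compChain c T m d (subsig d i ξ h)) ν = _
    rw [hstep]
    exact hT m m.lt_succ_self _ _ (by omega) (compChain c T m D ξ) i hle ν

/-- the `n`-fold composition of subsignal compatible transformations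
with dimensionality reduction constants `c 0, …, c (n-1)` is well-defined and is a
subsignal compatible transformation with dimensionality reduction constant
`(∑ c μ) - n + 1`. -/
theorem sct_comp_chain {M : ℕ → Type*} (n : ℕ) (hn : 2 ≤ n) (c : ℕ → ℕ)
    (hc : ∀ l, l < n → 0 < c l)
    (T : ∀ l : ℕ, ∀ D : ℕ, (Fin D → M l) → Fin (D + 1 - c l) → M (l + 1))
    (hT : ∀ l, l < n → IsSCT (c l) (T l)) :
    IsSCT (∑ μ ∈ Finset.range n, c μ - n + 1)
      (fun D ξ i => compChain c T n D ξ (Fin.cast (chainDim_eq c n hc D).symm i)) := by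
  intro d D _ ξ i h ν
  have hd : 0 < chainDim c n d := by
    rw [chainDim_eq c n hc]
    exact ν.pos
  exact congrFun (compChain_subsig c T ξ i h n hc hT (add_chainDim_le c n hc h hd)) _

end Scan
end

section
/- Let M be a set and k₁, k₂, q, s ∈ ℕ₊. Then Frag_{k₂}(Frag_{k₁}(ξ)) = Frag_{k₁k₂}(ξ) for all ξ ∈ M^{k₁k₂q×s}. Consequently, fragmentation is commutative: Frag_{k₂}(Frag_{k₁}(ξ)) = Frag_{k₁}(Frag_{k₂}(ξ)). -/
namespace Scan

/-- Vectorization operator: in 1-based indexing,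
`vec(ξ)_j = ξ_{((j−1) mod a)+1, ⌊(j−1)/a⌋+1}`. -/
def vec {M : Type*} {a b : ℕ} (ξ : Fin a → Fin b → M) : Fin (a * b) → M :=
  fun j => ξ
    ⟨j.val % a, by
      rcases Nat.eq_zero_or_pos a with h | h
      · exact absurd j.isLt (by simp [h])
      · exact Nat.mod_lt _ h⟩
    ⟨j.val / a, Nat.div_lt_of_lt_mul j.isLt⟩

/-- Inverse vectorization operator: in 1-based indexing,
`vec⁻¹(ξ)_{i,j} = ξ_{(j−1)a+i}`. -/
def vecInv {M : Type*} (a b : ℕ) (ξ : Fin (a * b) → M) : Fin a → Fin b → M :=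
  fun i j => ξ ⟨j.val * a + i.val, by
    have h1 : j.val * a + i.val < j.val * a + a := Nat.add_lt_add_left i.isLt _
    have h2 : j.val * a + a ≤ b * a := by
      calc j.val * a + a = (j.val + 1) * a := by ring
        _ ≤ b * a := Nat.mul_le_mul_right a j.isLt
    calc j.val * a + i.val < j.val * a + a := h1
      _ ≤ b * a := h2
      _ = a * b := Nat.mul_comm b a⟩

/-- Matrix transpose (fragmented signals are matrices, columns are fragments). -/
def mtrans {M : Type*} {a b : ℕ} (ξ : Fin a → Fin b → M) : Fin b → Fin a → M :=
  fun j i => ξ i j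

/-- The fragmentation operator `Frag_k : M^{kq×s} → M^{q×ks}`,
`ξ ↦ (vec⁻¹_{ks×q}(vec_{s×kq}(ξᵀ)))ᵀ`. -/
def frag {M : Type*} (k : ℕ) {q s : ℕ} (ξ : Fin (k * q) → Fin s → M) :
    Fin q → Fin (k * s) → M :=
  mtrans (vecInv (k * s) q (fun j => vec (mtrans ξ) (Fin.cast (by ring) j)))

/-- The defragmentation operator `Defrag_k : M^{q×ks} → M^{kq×s}`,
`ξ ↦ (vec⁻¹_{s×kq}(vec_{ks×q}(ξᵀ)))ᵀ`. -/
def defrag {M : Type*} (k : ℕ) {q s : ℕ} (ξ : Fin q → Fin (k * s) → M) :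
    Fin (k * q) → Fin s → M :=
  mtrans (vecInv s (k * q) (fun j => vec (mtrans ξ) (Fin.cast (by ring) j)))

/-- Fragmentation preserves the linear (row-major) index of an entry. -/
theorem exists_frag_eq {M : Type*} (k : ℕ) {q s : ℕ} (ξ : Fin (k * q) → Fin s → M)
    (μ : Fin q) (ν : Fin (k * s)) :
    ∃ (i : Fin (k * q)) (j : Fin s),
      i.val * s + j.val = μ.val * (k * s) + ν.val ∧ frag k ξ μ ν = ξ i j :=
  ⟨_, _, Nat.div_add_mod' _ _, rfl⟩

theorem linearIndex_injective {a s : ℕ} {i i' : Fin a} {j j' : Fin s}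
    (h : i.val * s + j.val = i'.val * s + j'.val) : i = i' ∧ j = j' := by
  have hs : 0 < s := j.pos
  have hdiv := congrArg (· / s) h
  have hmod := congrArg (· % s) h
  simp only [Nat.mul_comm _ s, Nat.mul_add_div hs, Nat.mul_add_mod,
    Nat.div_eq_of_lt j.isLt, Nat.div_eq_of_lt j'.isLt, Nat.mod_eq_of_lt j.isLt,
    Nat.mod_eq_of_lt j'.isLt, Nat.add_zero] at hdiv hmod
  exact ⟨Fin.ext hdiv, Fin.ext hmod⟩

theorem frag_eq_of_linearIndex_eq {M : Type*} (k : ℕ) {q s : ℕ}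
    (ξ : Fin (k * q) → Fin s → M) {μ : Fin q} {ν : Fin (k * s)}
    {i : Fin (k * q)} {j : Fin s}
    (h : i.val * s + j.val = μ.val * (k * s) + ν.val) : frag k ξ μ ν = ξ i j := by
  obtain ⟨i', j', h', e⟩ := exists_frag_eq k ξ μ ν
  obtain ⟨rfl, rfl⟩ := linearIndex_injective (h.trans h'.symm)
  exact e

theorem exists_frag_frag_eq {M : Type*} (k₁ k₂ : ℕ) {q s : ℕ}
    (ξ : Fin (k₁ * (k₂ * q)) → Fin s → M) (μ : Fin q) (ν : Fin (k₂ * (k₁ * s))) :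
    ∃ (i : Fin (k₁ * (k₂ * q))) (j : Fin s),
      i.val * s + j.val = μ.val * (k₂ * (k₁ * s)) + ν.val ∧
        frag k₂ (frag k₁ ξ) μ ν = ξ i j := by
  obtain ⟨i, j, h, e⟩ := exists_frag_eq k₂ (frag k₁ ξ) μ ν
  obtain ⟨i', j', h', e'⟩ := exists_frag_eq k₁ ξ i j
  exact ⟨i', j', h'.trans h, e.trans e'⟩

/-- compositions of fragmentations collapse into a single
fragmentation with the product parameter, and consequently fragmentation is
commutative.  (The `Fin.cast`s only mediate between the propositionally equal
dimensions `k₁·k₂·q`, `k₁·(k₂·q)`, `k₂·(k₁·q)` etc. of the index types.) -/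
theorem frag_frag {M : Type*} (k₁ k₂ q s : ℕ)
    (hk₁ : 0 < k₁) (hk₂ : 0 < k₂) (hq : 0 < q) (hs : 0 < s)
    (ξ : Fin (k₁ * (k₂ * q)) → Fin s → M) :
    (∀ (μ : Fin q) (ν : Fin (k₂ * (k₁ * s))),
      frag k₂ (frag k₁ ξ) μ ν =
        frag (k₁ * k₂)
          (fun (i : Fin (k₁ * k₂ * q)) (j : Fin s) => ξ (Fin.cast (by ring) i) j)
          μ (Fin.cast (by ring) ν)) ∧
    (∀ (μ : Fin q) (ν : Fin (k₂ * (k₁ * s))),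
      frag k₂ (frag k₁ ξ) μ ν =
        frag k₁
          (frag k₂
            (fun (i : Fin (k₂ * (k₁ * q))) (j : Fin s) => ξ (Fin.cast (by ring) i) j))
          μ (Fin.cast (by ring) ν)) := by
  refine ⟨fun μ ν => ?_, fun μ ν => ?_⟩ <;>
    obtain ⟨i, j, h, e⟩ := exists_frag_frag_eq k₁ k₂ ξ μ ν
  · rw [e, frag_eq_of_linearIndex_eq (k₁ * k₂) _ (i := Fin.cast (by ring) i) (j := j)]
    · rfl
    · simp only [Fin.val_cast, h]
      ring
  · obtain ⟨i', j', h', e'⟩ := exists_frag_frag_eq k₂ k₁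
      (fun (i : Fin (k₂ * (k₁ * q))) (j : Fin s) => ξ (Fin.cast (by ring) i) j)
      μ (Fin.cast (by ring) ν)
    rw [e, e']
    have hij : i.val * s + j.val =
        (Fin.cast (by ring : k₂ * (k₁ * q) = k₁ * (k₂ * q)) i').val * s + j'.val := by
      simp only [Fin.val_cast] at h' ⊢
      rw [h, h']
      ring
    obtain ⟨rfl, rfl⟩ := linearIndex_injective hij
    rfl

end Scan
end

section
/- Consider a strided-well-defined processing chain with receptive field size B, layers L, dimensionality reduction constants c_j, strides k_j and stride products k_j*. Let D ∈ ℕ₊ with D ≥ B be such that k_L* divides D − B + 1, and let ξ ∈ M₀^D. For j ∈ {0,…,L} let u_j := dim(EvalStride_j(Subsignal_B(ξ, i))) (independent of i), and let U_j^row and U_j^col denote the number of rows and columns of EvalSlide_j(ξ). Then EvalSlide_j(ξ) is well-defined for all j ∈ {0,…,L}, and: (a) u_j = (1/k_j*)·(B − Σ_{μ=1}^j k_{μ−1}*(c_μ − 1)); (b) U_j^row = (1/k_j*)·(D − k_j* + 1 − Σ_{μ=1}^j k_{μ−1}*(c_μ − 1)) and U_j^col = k_j*; (c) U_j^row − u_j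 + 1 = (D − B + 1)/k_j*. -/
namespace Scan

universe u v

/-- Application of a function in a strided fashion (to non-overlapping blocks). -/
def strideApp {M N : Type*} {k : ℕ} (g : (Fin k → M) → N) {D : ℕ} (ξ : Fin D → M) :
    Fin (D / k) → N :=
  fun i => g (subsig k (k * i.val) ξ (by
    have h1 : k * (i.val + 1) ≤ k * (D / k) := Nat.mul_le_mul_left k i.isLt
    have h2 : (D / k) * k ≤ D := Nat.div_mul_le_self D k
    have h3 : k * (D / k) = (D / k) * k := Nat.mul_comm _ _
    have h4 : k * (i.val + 1) = k * i.val + k := Nat.mul_succ k i.val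
    omega))

/-- Fragmentation of a matrix with an arbitrary number `r` of rows (the operator
agrees with `frag` whenever `k ∣ r`, which is guaranteed by the well-definedness
requirements of a processing chain). -/
def fragD {M : Type*} (k : ℕ) {r s : ℕ} (ξ : Fin r → Fin s → M) :
    Fin (r / k) → Fin (k * s) → M :=
  frag k (fun (i : Fin (k * (r / k))) j =>
    ξ (Fin.castLE (by
      calc k * (r / k) = (r / k) * k := Nat.mul_comm _ _
        _ ≤ r := Nat.div_mul_le_self r k) i) j)

/-- The stride products `k_j* = ∏_{ν=1}^j k_ν` of a processing chain. -/
def kstar (k : ℕ → ℕ) (j : ℕ) : ℕ := ∏ ν ∈ Finset.range j, k ν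

section Chain

variable (M : ℕ → Type u) (Nt : ℕ → Type v) (c k : ℕ → ℕ)
  (T : ∀ j : ℕ, ∀ Dq : ℕ, (Fin Dq → M j) → Fin (Dq + 1 - c j) → Nt j)
  (g : ∀ j : ℕ, (Fin (k j) → Nt j) → M (j + 1))

/-- Application of a processing chain in a strided fashion (`EvalStride`);
layer `j+1` of the paper corresponds to the data `T j`, `g j`, `c j`, `k j`. -/
def evalStride (B : ℕ) : (j : ℕ) → (ρ : Fin B → M 0) → Σ q : ℕ, Fin q → M j
  | 0, ρ => ⟨B, ρ⟩
  | j + 1, ρ =>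
    let p := evalStride B j ρ
    ⟨(p.1 + 1 - c j) / k j, strideApp (g j) (T j p.1 p.2)⟩

/-- Application of a processing chain in a sliding fashion (`EvalSlide`), producing
a fragmented signal, encoded as `⟨rows, cols, matrix⟩`; the subsignal compatible
transformation `T j` and the sliding application of `g j` act on each fragment
(column) independently, followed by fragmentation. -/
def evalSlide (D : ℕ) : (j : ℕ) → (ξ : Fin D → M 0) → Σ r : ℕ, Σ s : ℕ, Fin r → Fin s → M j
  | 0, ξ => ⟨D, 1, fun i _ => ξ i⟩
  | j + 1, ξ =>
    let p := evalSlide D j ξ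
    let A : Fin (p.1 + 1 - c j) → Fin p.2.1 → Nt j :=
      fun i col => T j p.1 (fun i' => p.2.2 i' col) i
    let Bm : Fin ((p.1 + 1 - c j) + 1 - k j) → Fin p.2.1 → M (j + 1) :=
      fun i col => slide (g j) (fun i' => A i' col) i
    ⟨((p.1 + 1 - c j) + 1 - k j) / k j, k j * p.2.1, fragD (k j) Bm⟩

/-- A processing chain is strided-well-defined if in every layer the stride `k j`
divides the dimensionality of `T j (EvalStride_j ρ)` and the resulting signal is
non-empty. -/
def StridedWellDefined (B L : ℕ) : Prop :=
  ∀ j, j < L → ∀ ρ : Fin B → M 0,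
    (k j ∣ ((evalStride M Nt c k T g B j ρ).1 + 1 - c j)) ∧
    0 < (evalStride M Nt c k T g B (j + 1) ρ).1

/-- Up to layer `L`, the strided application of a strided-well-defined processing chain has
positive dimensionality `u_j` with `k_j* u_j + ∑ μ < j, k_μ* (c_μ - 1) = B`. -/
theorem StridedWellDefined.pos_and_kstar_mul_add_sum {B L : ℕ}
    (hwd : StridedWellDefined M Nt c k T g B L) (hB : 0 < B) (hc : ∀ j, j < L → 0 < c j)
    (ρ : Fin B → M 0) {j : ℕ} (hj : j ≤ L) :
    0 < (evalStride M Nt c k T g B j ρ).1 ∧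
      kstar k j * (evalStride M Nt c k T g B j ρ).1 +
        ∑ μ ∈ Finset.range j, kstar k μ * (c μ - 1) = B := by
  induction j with
  | zero => simpa [evalStride, kstar] using hB
  | succ j ih =>
    obtain ⟨-, hsum⟩ := ih (by omega)
    obtain ⟨hdvd, hpos⟩ := hwd j hj ρ
    refine ⟨hpos, ?_⟩
    have hcj := hc j hj
    have hmul : k j * (evalStride M Nt c k T g B (j + 1) ρ).1 =
        (evalStride M Nt c k T g B j ρ).1 + 1 - c j := Nat.mul_div_cancel' hdvd
    have hne : (evalStride M Nt c k T g B j ρ).1 + 1 - c j ≠ 0 := by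
      intro h
      have : (evalStride M Nt c k T g B (j + 1) ρ).1 = 0 := by simp [evalStride, h]
      omega
    have hstep : k j * (evalStride M Nt c k T g B (j + 1) ρ).1 + (c j - 1) =
        (evalStride M Nt c k T g B j ρ).1 := by omega
    rw [Finset.sum_range_succ, show kstar k (j + 1) = kstar k j * k j from
      Finset.prod_range_succ k j]
    rw [← hstep] at hsum
    linarith

theorem kstar_dvd_kstar {i j : ℕ} (h : i ≤ j) : kstar k i ∣ kstar k j :=
  Finset.prod_dvd_prod_of_subset _ _ _ (Finset.range_mono h)

theorem kstar_pos {L : ℕ} (hk : ∀ j, j < L → 0 < k j) {j : ℕ} (hj : j ≤ L) : 0 < kstar k j :=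
  Finset.prod_pos fun i hi => hk i ((Finset.mem_range.mp hi).trans_le hj)

theorem div_kstar_eq {L : ℕ} (hk : ∀ j, j < L → 0 < k j) {j n : ℕ} (hj : j < L)
    (hdiv : kstar k L ∣ n) : n / kstar k j = k j * (n / kstar k (j + 1)) := by
  obtain ⟨m, rfl⟩ := (kstar_dvd_kstar k hj).trans hdiv
  rw [Nat.mul_div_cancel_left _ (kstar_pos k hk hj),
    show kstar k (j + 1) = kstar k j * k j from Finset.prod_range_succ k j, mul_assoc,
    Nat.mul_div_cancel_left _ (kstar_pos k hk hj.le)]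

theorem evalSlide_cols {D : ℕ} (ξ : Fin D → M 0) (j : ℕ) :
    (evalSlide M Nt c k T g D j ξ).2.1 = kstar k j := by
  induction j with
  | zero => simp [evalSlide, kstar]
  | succ j ih =>
    rw [show kstar k (j + 1) = kstar k j * k j from Finset.prod_range_succ k j, ← ih, mul_comm]
    rfl

/-- One layer of the chain: if `u` and `U` are the dimensionalities before the layer, with
`U + 1 = u + k * q`, then the fragmentation after the layer comes out even. -/
theorem slide_rows_eq_mul {u U c k q : ℕ} (hk : 0 < k) (hq : 0 < q) (hU : U + 1 = u + k * q)
    (hdvd : k ∣ u + 1 - c) (hpos : 0 < (u + 1 - c) / k) :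
    U + 1 - c + 1 - k = k * ((u + 1 - c) / k + q - 1) := by
  have hmul := Nat.mul_div_cancel' hdvd
  have hk1 : k * 1 ≤ k * q := Nat.mul_le_mul_left k hq
  have hk2 : k * 1 ≤ k * ((u + 1 - c) / k) := Nat.mul_le_mul_left k hpos
  rw [Nat.mul_sub, Nat.mul_add, hmul]
  omega

theorem StridedWellDefined.evalSlide_rows_add_one {B L : ℕ}
    (hwd : StridedWellDefined M Nt c k T g B L) (hk : ∀ j, j < L → 0 < k j)
    {D : ℕ} (hD : B ≤ D) (hdiv : kstar k L ∣ D - B + 1) (ρ : Fin B → M 0) (ξ : Fin D → M 0)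
    {j : ℕ} (hj : j ≤ L) :
    (evalSlide M Nt c k T g D j ξ).1 + 1 =
      (evalStride M Nt c k T g B j ρ).1 + (D - B + 1) / kstar k j := by
  induction j with
  | zero =>
    simp only [evalSlide, evalStride, kstar, Finset.range_zero, Finset.prod_empty, Nat.div_one]
    omega
  | succ j ih =>
    obtain ⟨hdvd, hpos⟩ := hwd j hj ρ
    have hq : 0 < (D - B + 1) / kstar k (j + 1) :=
      Nat.div_pos (Nat.le_of_dvd (by omega) ((kstar_dvd_kstar k hj).trans hdiv))
        (kstar_pos k hk hj)
    have hrow := slide_rows_eq_mul (hk j hj) hq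
      ((ih (by omega)).trans (by rw [div_kstar_eq k hk hj hdiv])) hdvd hpos
    have hdef : (evalSlide M Nt c k T g D (j + 1) ξ).1 =
        ((evalSlide M Nt c k T g D j ξ).1 + 1 - c j + 1 - k j) / k j := rfl
    have hdef' : (evalStride M Nt c k T g B (j + 1) ρ).1 =
        ((evalStride M Nt c k T g B j ρ).1 + 1 - c j) / k j := rfl
    rw [hdef, hrow, Nat.mul_div_cancel_left _ (hk j hj), hdef']
    omega

/-- dimensions of the strided and sliding applications of a
strided-well-defined processing chain.  With `u_j` the dimensionality of
`EvalStride_j` (evaluated on the first subsignal; it is independent of the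
subsignal), `U_j^row`/`U_j^col` the dimensions of `EvalSlide_j(ξ)`:
the sliding application is well-defined (every fragmentation comes out even), and
(a) `u_j = (B − Σ_{μ<j} k_μ*·(c_μ − 1)) / k_j*`;
(b) `U_j^row = (D − k_j* + 1 − Σ_{μ<j} k_μ*·(c_μ − 1)) / k_j*` and `U_j^col = k_j*`;
(c) `U_j^row − u_j + 1 = (D − B + 1) / k_j*`. -/
theorem evalSlide_dims (M : ℕ → Type u) (Nt : ℕ → Type v) (c k : ℕ → ℕ)
    (T : ∀ j : ℕ, ∀ Dq : ℕ, (Fin Dq → M j) → Fin (Dq + 1 - c j) → Nt j)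
    (g : ∀ j : ℕ, (Fin (k j) → Nt j) → M (j + 1))
    (B L : ℕ) (hB : 0 < B) (hL : 0 < L)
    (hc : ∀ j, j < L → 0 < c j) (hk : ∀ j, j < L → 0 < k j)
    (hT : ∀ j, j < L → IsSCT (c j) (T j))
    (hwd : StridedWellDefined M Nt c k T g B L)
    (D : ℕ) (hD : B ≤ D) (hdiv : kstar k L ∣ (D - B + 1))
    (ξ : Fin D → M 0) :
    (∀ j, j < L →
      k j ∣ (((evalSlide M Nt c k T g D j ξ).1 + 1 - c j) + 1 - k j)) ∧
    (∀ j, j ≤ L →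
      (evalStride M Nt c k T g B j (subsig B 0 ξ (by omega))).1 =
        (B - ∑ μ ∈ Finset.range j, kstar k μ * (c μ - 1)) / kstar k j) ∧
    (∀ j, j ≤ L →
      (evalSlide M Nt c k T g D j ξ).1 =
        (D - kstar k j + 1 - ∑ μ ∈ Finset.range j, kstar k μ * (c μ - 1)) / kstar k j ∧
      (evalSlide M Nt c k T g D j ξ).2.1 = kstar k j) ∧
    (∀ j, j ≤ L →
      (evalSlide M Nt c k T g D j ξ).1 -
          (evalStride M Nt c k T g B j (subsig B 0 ξ (by omega))).1 + 1 =
        (D - B + 1) / kstar k j) := by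
  have hu := fun j (hj : j ≤ L) =>
    hwd.pos_and_kstar_mul_add_sum M Nt c k T g hB hc (subsig B 0 ξ (by omega)) hj
  have hU := fun j (hj : j ≤ L) =>
    hwd.evalSlide_rows_add_one M Nt c k T g hk hD hdiv (subsig B 0 ξ (by omega)) ξ hj
  have hpos := fun j (hj : j ≤ L) => kstar_pos k hk hj
  refine ⟨fun j hj => ?_, fun j hj => ?_, fun j hj => ⟨?_, evalSlide_cols M Nt c k T g ξ j⟩,
    fun j hj => ?_⟩
  · obtain ⟨hdvd, hne⟩ := hwd j hj (subsig B 0 ξ (by omega))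
    have hq : 0 < (D - B + 1) / kstar k (j + 1) :=
      Nat.div_pos (Nat.le_of_dvd (by omega) ((kstar_dvd_kstar k hj).trans hdiv)) (hpos _ hj)
    rw [slide_rows_eq_mul (hk j hj) hq
      ((hU j hj.le).trans (by rw [div_kstar_eq k hk hj hdiv])) hdvd hne]
    exact dvd_mul_right _ _
  · refine (Nat.div_eq_of_eq_mul_right (hpos j hj) ?_).symm
    have := (hu j hj).2
    omega
  · refine (Nat.div_eq_of_eq_mul_right (hpos j hj) ?_).symm
    obtain ⟨hu0, husum⟩ := hu j hj
    have hle := Nat.mul_le_mul_left (kstar k j) hu0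
    have hmul := congrArg (kstar k j * ·) (hU j hj)
    simp only [Nat.mul_add, Nat.mul_div_cancel' ((kstar_dvd_kstar k hj).trans hdiv)] at hmul
    omega
  · have := hU j hj
    have hq : 0 < (D - B + 1) / kstar k j :=
      Nat.div_pos (Nat.le_of_dvd (by omega) ((kstar_dvd_kstar k hj).trans hdiv)) (hpos _ hj)
    omega

end Chain

end Scan
end

section
/- Let M be a set, k ∈ ℕ with k ≥ 2, h ∈ ℕ₊ with h ≥ k, H : M^h → M, B ∈ ℕ₊, and let θ be a boundary-handling function on signals over M. Set R̃ := (k−1)·B + h − k and R := ⌈R̃/2⌉. Let ξ ∈ M^D with D ≥ B and let π := Downsampling_k(Slide_H(Padding_R^θ(ξ))). Then: (i) dim(π) = ⌈(D − B + 1 + (R̃ mod 2))/k⌉ + B − 1; (ii) for every i ∈ {1,…,D−B+1}, writing j := MultiScaleIndex_k(i), one has j ∈ {1,…,D−B+1}, j ≤ i and i − j < k; (iii) for every i ∈ {1,…,D−B+1}: Subsignal_B(π, ⌊(i−1)/k⌋+1) = MultiScaleSubsignal_{(B,R,k)}^{(θ,H)}(ξ, MultiScaleIndex_k(i)), both sides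 being well-defined signals in M^B. -/
namespace Scan

/-- A boundary-handling function returns the original sample whenever the 1-based
integer index is within bounds. -/
def IsBoundary {M : Type*} (θ : ∀ D : ℕ, (Fin D → M) → ℤ → M) : Prop :=
  ∀ (D : ℕ) (ξ : Fin D → M) (ν : ℤ) (h1 : 1 ≤ ν) (h2 : ν ≤ (D : ℤ)),
    θ D ξ ν = ξ ⟨ν.toNat - 1, by omega⟩

/-- The padding operator: the `ν`-th sample (1-based) of `Padding_R^θ(ξ)` is
`θ(ξ, ν − R)`. -/
def padth {M : Type*} (θ : ∀ D : ℕ, (Fin D → M) → ℤ → M) (R : ℕ) {D : ℕ}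
    (ξ : Fin D → M) : Fin (D + 2 * R) → M :=
  fun ν => θ D ξ ((ν.val : ℤ) + 1 - R)

/-- The padded subsignal extraction operator: the `ν`-th sample (1-based) of
`SubsignalPad_{(d,R)}^θ(ξ, i)` is `θ(ξ, i + ν − R − 1)`; here `i` is 0-based
(the paper's subsignal index is `i + 1`). -/
def subsigPad {M : Type*} (θ : ∀ D : ℕ, (Fin D → M) → ℤ → M) (d R : ℕ) {D : ℕ}
    (ξ : Fin D → M) (i : ℕ) : Fin (d + 2 * R) → M :=
  fun ν => θ D ξ ((i : ℤ) + (ν.val : ℤ) + 1 - R)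

/-- The downsampling operator: the `ν`-th sample (1-based) of `Downsampling_k(ξ)`
is `ξ_{k(ν−1)+1}`; the output has `⌈D/k⌉ = (D + k − 1)/k` samples. -/
def downs {M : Type*} (k : ℕ) {D : ℕ} (ξ : Fin D → M) : Fin ((D + k - 1) / k) → M :=
  fun ν => ξ ⟨k * ν.val, by
    have hν := ν.isLt
    rcases Nat.eq_zero_or_pos k with hk | hk
    · subst hk; omega
    · have h1 : k * (ν.val + 1) ≤ k * ((D + k - 1) / k) := Nat.mul_le_mul_left k hν
      have h2 : ((D + k - 1) / k) * k ≤ D + k - 1 := Nat.div_mul_le_self _ k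
      have h3 : k * ((D + k - 1) / k) = ((D + k - 1) / k) * k := Nat.mul_comm _ _
      have h4 : k * (ν.val + 1) = k * ν.val + k := Nat.mul_succ k ν.val
      omega⟩

/-- The multi-scale subsignal index transformation (0-based: the paper's 1-based
`MultiScaleIndex_k(i) = k⌊(i−1)/k⌋ + 1` becomes `i ↦ k·⌊i/k⌋`). -/
def msIdx (k i : ℕ) : ℕ := k * (i / k)

/-- The multi-scale subsignal extraction operator
`MultiScaleSubsignal_{(d,R,k)}^{(θ,H)}(ξ, i) =
Downsampling_k(Slide_H(SubsignalPad_{(d,R)}^θ(ξ, i)))`. -/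
def msSub {M : Type*} (θ : ∀ D : ℕ, (Fin D → M) → ℤ → M) {h : ℕ}
    (H : (Fin h → M) → M) (d R k : ℕ) {D : ℕ} (ξ : Fin D → M) (i : ℕ) :
    Fin ((d + 2 * R + 1 - h + k - 1) / k) → M :=
  downs k (slide H (subsigPad θ d R ξ i))

/-- properties of multi-scale subsignal extraction.  With
`R̃ = (k−1)B + h − k`, `R = ⌈R̃/2⌉` and the downscaled signal
`π = Downsampling_k(Slide_H(Padding_R^θ(ξ)))`:
(i) `dim(π) = ⌈(D − B + 1 + (R̃ mod 2))/k⌉ + B − 1`;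
(ii) the transformed index `MultiScaleIndex_k(i)` is a valid subsignal index,
it is at most `i`, and it differs from `i` by less than `k` (0-based indexing);
(iii) the multi-scale subsignal has exactly `B` samples, the subsignal
`Subsignal_B(π, ⌊i/k⌋)` is well-defined, and it equals
`MultiScaleSubsignal_{(B,R,k)}^{(θ,H)}(ξ, MultiScaleIndex_k(i))` sample-wise. -/
theorem multiscale_props {M : Type*} (k hsz B : ℕ) (hk : 2 ≤ k) (hhk : k ≤ hsz)
    (hB : 0 < B)
    (θ : ∀ D : ℕ, (Fin D → M) → ℤ → M) (hθ : IsBoundary θ)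
    (H : (Fin hsz → M) → M)
    (R' R : ℕ) (hR' : R' = (k - 1) * B + hsz - k) (hR : R = (R' + 1) / 2)
    {D : ℕ} (hD : B ≤ D) (ξ : Fin D → M) :
    ((D + 2 * R + 1 - hsz + k - 1) / k = (D - B + 1 + R' % 2 + k - 1) / k + B - 1) ∧
    (∀ i : ℕ, i ≤ D - B → msIdx k i ≤ D - B ∧ msIdx k i ≤ i ∧ i - msIdx k i < k) ∧
    ((B + 2 * R + 1 - hsz + k - 1) / k = B) ∧
    (∀ i : ℕ, i ≤ D - B → i / k + B ≤ (D + 2 * R + 1 - hsz + k - 1) / k) ∧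
    (∀ (i : ℕ), i ≤ D - B → ∀ (ν : ℕ) (hν : ν < B)
      (h1 : i / k + ν < (D + 2 * R + 1 - hsz + k - 1) / k)
      (h2 : ν < (B + 2 * R + 1 - hsz + k - 1) / k),
      downs k (slide H (padth θ R ξ)) ⟨i / k + ν, h1⟩ =
        msSub θ H B R k ξ (msIdx k i) ⟨ν, h2⟩) := by
  have hkB : k ≤ k * B := Nat.le_mul_of_pos_right k hB
  have hk1 : (k - 1) * B = k * B - B := by rw [Nat.sub_mul, one_mul]
  have hBk : B ≤ k * B := Nat.le_mul_of_pos_left B (by omega)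
  have hk0 : 0 < k := by omega
  have hlen (n : ℕ) (hn : B ≤ n) :
      (n + 2 * R + 1 - hsz + k - 1) / k = (n - B + R' % 2) / k + B := by
    rw [← Nat.add_mul_div_left _ _ hk0]
    congr 1
    omega
  have hidx (i : ℕ) : msIdx k i ≤ i := Nat.mul_div_le i k
  refine ⟨?_, fun i hi => ⟨(hidx i).trans hi, hidx i, ?_⟩, ?_, fun i hi => ?_, ?_⟩
  · have hceil : (D - B + 1 + R' % 2 + k - 1) / k = (D - B + R' % 2) / k + 1 := by
      rw [← Nat.add_div_right _ hk0]
      congr 1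
      omega
    rw [hlen D hD, hceil, add_right_comm, Nat.add_sub_cancel]
  · have hdiv := Nat.div_add_mod i k
    have hmod := Nat.mod_lt i hk0
    unfold msIdx
    omega
  · rw [hlen B le_rfl, Nat.div_eq_of_lt (by omega), zero_add]
  · rw [hlen D hD]
    exact Nat.add_le_add_right (Nat.div_le_div_right (by omega)) B
  · intro i _ ν _ _ _
    simp only [msSub, downs, slide]
    congr 1
    funext μ
    simp only [subsig, padth, subsigPad, msIdx]
    congr 1
    push_cast
    ring

end Scan
end

section
/- Let M, N be sets, c ∈ ℕ₊, f : M^c → N a function, and k ∈ ℕ₊. Then for every signal ξ ∈ M^D with D ≥ k(c−1)+1 such that k divides D: Dilate_{(f,k)}(ξ) = Defrag_k(Slide_f(Frag_k(ξ))), where ξ is viewed as a one-column fragmented signal, Slide_f is applied to each fragment (column) independently, and the result is a one-column fragmented signal with D − k(c−1) samples. -/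
namespace Scan

/-- Application of a function in a dilated fashion with stride `k` (the `ν`-th
sample of the dilated subsignal at 0-based index `i` is `ξ_{i + k·ν}`). -/
def dilate {A N' : Type*} {cc : ℕ} (f : (Fin cc → A) → N') (kk : ℕ) {D : ℕ}
    (ξ : Fin D → A) : Fin (D - kk * (cc - 1)) → N' :=
  fun i => f (fun ν => ξ ⟨i.val + kk * ν.val, by
    have h1 : kk * ν.val ≤ kk * (cc - 1) :=
      Nat.mul_le_mul_left kk (by have := ν.isLt; omega)
    have h2 := i.isLt
    omega⟩)

/-- application of a function in a dilated fashion equals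
fragmentation, followed by sliding application on each fragment (column)
independently, followed by defragmentation.  The input signal is viewed as a
one-column fragmented signal; since `k ∣ D`, the `Fin.cast` only mediates the
propositionally equal dimensions `k·(D/k) = D`.  The outputs (the left-hand side,
and the single column of the right-hand side) have `D − k(c−1)` samples and
coincide sample-wise. -/
theorem dilate_eq_defrag_slide_frag {M N : Type*} (c k : ℕ) (hc : 0 < c) (hk : 0 < k)
    (f : (Fin c → M) → N) {D : ℕ} (hD : k * (c - 1) + 1 ≤ D) (hdvd : k ∣ D)
    (ξ : Fin D → M) :
    (k * (D / k + 1 - c) = D - k * (c - 1)) ∧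
    (∀ (i : ℕ) (h1 : i < D - k * (c - 1)) (h2 : i < k * (D / k + 1 - c))
      (h3 : (0 : ℕ) < 1),
      dilate f k ξ ⟨i, h1⟩ =
        defrag k
          (fun (i' : Fin (D / k + 1 - c)) (col : Fin (k * 1)) =>
            slide f
              (fun i'' =>
                frag k
                  (fun (r : Fin (k * (D / k))) (_ : Fin 1) =>
                    ξ (Fin.cast (Nat.mul_div_cancel' hdvd) r))
                  i'' col)
              i')
          ⟨i, h2⟩ ⟨0, h3⟩) := by
  refine ⟨?_, ?_⟩
  · obtain ⟨q, rfl⟩ := hdvd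
    obtain ⟨m, rfl⟩ : ∃ m, c = m + 1 := ⟨c - 1, by omega⟩
    rw [Nat.mul_div_cancel_left q hk, Nat.add_sub_add_right, Nat.add_sub_cancel, Nat.mul_sub]
  · intro i h1 h2 h3
    simp only [dilate, defrag, mtrans, vecInv, vec, slide, frag]
    congr 1
    funext ν
    congr 1
    apply Fin.ext
    simp only [Fin.val_cast, mul_one, add_zero, Nat.div_one]
    rw [add_mul, mul_comm (i / k) k, mul_comm k ν.val]
    have := Nat.div_add_mod i k
    omega

end Scan
end

section
/- Consider a strided-well-defined processing chain with receptive field size B, layers L, subsignal compatible transformations T_j generated by the unique functions f_j : M_{j−1}^{c_j} → N_j with T_j = Slide_{f_j}, functions g_j, strides k_j and stride products k_j*. Assume dim(EvalStride_L(ρ)) = 1 for all ρ ∈ M₀^B. Then EvalDilate_L is well-defined on all signals ξ ∈ M₀^D with D ≥ B, and EvalDilate_L = Slide_{EvalStride_L}; in particular, EvalDilate_L is a subsignal compatible transformation with dimensionality reduction constant B, i.e. for every ξ ∈ M₀^D with D ≥ B, EvalDilate_L(ξ) has D − B + 1 samples and its i-th sample equals EvalStride_L(Subsignal_B(ξ,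 i)). -/
namespace Scan

universe u v

section Chain

variable (M : ℕ → Type u) (Nt : ℕ → Type v) (c k : ℕ → ℕ)
  (T : ∀ j : ℕ, ∀ Dq : ℕ, (Fin Dq → M j) → Fin (Dq + 1 - c j) → Nt j)
  (g : ∀ j : ℕ, (Fin (k j) → Nt j) → M (j + 1))

/-- Application of a processing chain in a dilated fashion (`EvalDilate`), where
`f j` is the unique function generating the subsignal compatible transformation
`T j` in the sense that `T j = Slide (f j)`. -/
def evalDilate (f : ∀ j : ℕ, (Fin (c j) → M j) → Nt j) (D : ℕ) :
    (j : ℕ) → (ξ : Fin D → M 0) → Σ q : ℕ, Fin q → M j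
  | 0, ξ => ⟨D, ξ⟩
  | j + 1, ξ =>
    let p := evalDilate f D j ξ
    ⟨p.1 - kstar k j * (c j - 1) - kstar k j * (k j - 1),
      dilate (g j) (kstar k j) (dilate (f j) (kstar k j) p.2)⟩

theorem dilate_eq_slide {A N' : Type*} {cc : ℕ} (f : (Fin cc → A) → N') {K D E : ℕ}
    (ξ : Fin D → A) (η : Fin E → A) (i : ℕ)
    (hval : ∀ ν (hν : ν < E) (h : i + K * ν < D), ξ ⟨i + K * ν, h⟩ = η ⟨ν, hν⟩)
    (ν : ℕ) (hν : ν < E + 1 - cc) (h : i + K * ν < D - K * (cc - 1)) :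
    dilate f K ξ ⟨i + K * ν, h⟩ = slide f η ⟨ν, hν⟩ := by
  unfold dilate slide subsig
  congr 1
  funext b
  have hb := b.isLt
  have hle : K * b.val ≤ K * (cc - 1) := Nat.mul_le_mul_left K (by omega)
  have e : i + K * ν + K * b.val = i + K * (ν + b.val) := by ring
  have hlt : i + K * (ν + b.val) < D := by omega
  rw [← hval (ν + b.val) (by omega) hlt]
  exact congrArg ξ (Fin.ext e)

theorem dilate_eq_strideApp {A N' : Type*} {k : ℕ} (g : (Fin k → A) → N') {K D E : ℕ}
    (ξ : Fin D → A) (η : Fin E → A) (i : ℕ)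
    (hval : ∀ ν (hν : ν < E) (h : i + K * ν < D), ξ ⟨i + K * ν, h⟩ = η ⟨ν, hν⟩)
    (ν : ℕ) (hν : ν < E / k) (h : i + K * k * ν < D - K * (k - 1)) :
    dilate g K ξ ⟨i + K * k * ν, h⟩ = strideApp g η ⟨ν, hν⟩ := by
  unfold dilate strideApp subsig
  congr 1
  funext b
  have hb := b.isLt
  have hle : K * b.val ≤ K * (k - 1) := Nat.mul_le_mul_left K (by omega)
  have e : i + K * k * ν + K * b.val = i + K * (k * ν + b.val) := by ring
  have hlt : i + K * (k * ν + b.val) < D := by omega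
  have hE : k * ν + b.val < E := by
    have h1 : k * (ν + 1) ≤ k * (E / k) := Nat.mul_le_mul_left k hν
    have h2 := Nat.mul_div_le E k
    have h3 : k * (ν + 1) = k * ν + k := Nat.mul_succ k ν
    omega
  rw [← hval (k * ν + b.val) hE hlt]
  exact congrArg ξ (Fin.ext e)

theorem dilate_length_step {B D K k c m p q : ℕ} (hc : 0 < c) (hm : 0 < m) (hk : 0 < k)
    (hp : p + 1 - c = k * m) (hq : q + B = D + 1 + K * (p - 1)) (hBD : B ≤ D) :
    q - K * (c - 1) - K * (k - 1) + B = D + 1 + K * k * (m - 1) := by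
  obtain ⟨c, rfl⟩ : ∃ a, c = a + 1 := ⟨c - 1, by omega⟩
  obtain ⟨m, rfl⟩ : ∃ a, m = a + 1 := ⟨m - 1, by omega⟩
  obtain ⟨k, rfl⟩ : ∃ a, k = a + 1 := ⟨k - 1, by omega⟩
  have hpos : 0 < (k + 1) * (m + 1) := by positivity
  have e : p - 1 = (k + 1) * m + k + c := by
    have : (k + 1) * (m + 1) = (k + 1) * m + k + 1 := by ring
    omega
  rw [e] at hq
  have e2 : K * ((k + 1) * m + k + c) = K * (k + 1) * m + K * k + K * c := by ring
  simp only [Nat.add_sub_cancel]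
  omega

theorem evalDilate_evalStride_layer (B L : ℕ) (hB : 0 < B)
    (hc : ∀ j, j < L → 0 < c j) (hk : ∀ j, j < L → 0 < k j)
    (f : ∀ j : ℕ, (Fin (c j) → M j) → Nt j)
    (hTf : ∀ j, j < L → ∀ (Dq : ℕ) (ξ : Fin Dq → M j), T j Dq ξ = slide (f j) ξ)
    (hwd : StridedWellDefined M Nt c k T g B L)
    (D : ℕ) (ξ : Fin D → M 0) (i : ℕ) (hiB : i + B ≤ D) (j : ℕ) (hj : j ≤ L) :
    (evalDilate M Nt c k g f D j ξ).1 + B =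
        D + 1 + kstar k j * ((evalStride M Nt c k T g B j (subsig B i ξ hiB)).1 - 1) ∧
      ∀ ν (hν : ν < (evalStride M Nt c k T g B j (subsig B i ξ hiB)).1)
        (h : i + kstar k j * ν < (evalDilate M Nt c k g f D j ξ).1),
        (evalDilate M Nt c k g f D j ξ).2 ⟨i + kstar k j * ν, h⟩ =
          (evalStride M Nt c k T g B j (subsig B i ξ hiB)).2 ⟨ν, hν⟩ := by
  induction j with
  | zero =>
    refine ⟨by simp [evalDilate, evalStride, kstar]; omega, fun ν hν h => ?_⟩
    exact congrArg ξ (Fin.ext (by simp [kstar]))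
  | succ j ih =>
    obtain ⟨hlen, hval⟩ := ih (by omega)
    obtain ⟨⟨m, hm⟩, hpos⟩ := hwd j hj (subsig B i ξ hiB)
    have hkj := hk j hj
    have hdiv : (evalStride M Nt c k T g B (j + 1) (subsig B i ξ hiB)).1 = m := by
      simp only [evalStride, hm, Nat.mul_div_cancel_left m hkj]
    have hks : kstar k (j + 1) = kstar k j * k j := Finset.prod_range_succ k j
    refine ⟨?_, ?_⟩
    · rw [hdiv, hks]
      exact dilate_length_step (hc j hj) (hdiv ▸ hpos) hkj hm hlen (by omega)
    · rw [hks]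
      intro ν hν h
      refine dilate_eq_strideApp (g j) _ _ i (fun μ hμ h' => ?_) ν hν h
      rw [hTf j hj]
      exact dilate_eq_slide (f j) _ _ i hval μ hμ h'

/-- for a strided-well-defined processing chain whose strided
application outputs exactly one sample, the dilated application `EvalDilate_L` is
well-defined on every signal with at least `B` samples (its construction above is
total) and equals `Slide_{EvalStride_L}`: it produces `D − B + 1` samples and its
`i`-th sample is `EvalStride_L(Subsignal_B(ξ, i))`; in particular it is a
subsignal compatible transformation with dimensionality reduction constant `B`. -/
theorem evalDilate_eq_slide_evalStride (B L : ℕ) (hB : 0 < B) (hL : 0 < L)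
    (hc : ∀ j, j < L → 0 < c j) (hk : ∀ j, j < L → 0 < k j)
    (hT : ∀ j, j < L → IsSCT (c j) (T j))
    (f : ∀ j : ℕ, (Fin (c j) → M j) → Nt j)
    (hTf : ∀ j, j < L → ∀ (Dq : ℕ) (ξ : Fin Dq → M j), T j Dq ξ = slide (f j) ξ)
    (hwd : StridedWellDefined M Nt c k T g B L)
    (hu1 : ∀ ρ : Fin B → M 0, (evalStride M Nt c k T g B L ρ).1 = 1) :
    ∀ (D : ℕ), B ≤ D → ∀ ξ : Fin D → M 0,
      (evalDilate M Nt c k g f D L ξ).1 = D - B + 1 ∧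
      ∀ (i : ℕ) (hiB : i + B ≤ D)
        (h1 : i < (evalDilate M Nt c k g f D L ξ).1)
        (h2 : 0 < (evalStride M Nt c k T g B L (subsig B i ξ hiB)).1),
        (evalDilate M Nt c k g f D L ξ).2 ⟨i, h1⟩ =
          (evalStride M Nt c k T g B L (subsig B i ξ hiB)).2 ⟨0, h2⟩ := by
  intro D hBD ξ
  have key := evalDilate_evalStride_layer M Nt c k T g B L hB hc hk f hTf hwd D ξ
  refine ⟨?_, fun i hiB h1 h2 => ?_⟩
  · have hlen := (key 0 (by omega) L le_rfl).1
    rw [hu1] at hlen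
    omega
  · exact (key i hiB L le_rfl).2 0 h2 h1

end Chain

end Scan
end
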